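/- There exists a set 𝒢₀ ⊆ R=[0,1]×[−1,1] which contains a residual subset of R and whose complement in R has Lebesgue measure zero, such that for every (ρ,α)∈𝒢₀ the forward orbit {T^n(ρ,α) : n≥0} is dense in R. -/

import Mathlib

noncomputable section

open Set Filter MeasureTheory Topology

/-- The Gauss map `G(ρ) = {1/ρ}`, `G(0) = 0`. -/
def gaussMap (ρ : ℝ) : ℝ := if ρ = 0 then 0 else Int.fract (1 / ρ)

/-- The fiber maps `T_ρ : [-1,1] → [-1,1]` of the skew product. -/
def fiberMap (ρ α : ℝ) : ℝ :=
  if ρ = 0 then 0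
  else if α ≤ 0 then -α
  else if α ≤ ρ * gaussMap ρ then -α / (ρ * gaussMap ρ)
  else Int.fract ((1 - α) / ρ)

/-- The skew product `T(ρ,α) = (G(ρ), T_ρ(α))`. -/
def skewProd (p : ℝ × ℝ) : ℝ × ℝ := (gaussMap p.1, fiberMap p.1 p.2)

/-- The rectangle `R = [0,1] × [-1,1]`. -/
def Rect : Set (ℝ × ℝ) := Icc (0 : ℝ) 1 ×ˢ Icc (-1 : ℝ) 1

/-- `M = ([0,1] ∖ ℚ) × [-1,1]`. -/
def Mset : Set (ℝ × ℝ) := {p | p ∈ Rect ∧ Irrational p.1}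

/-- The `n`-th partial quotient of the continued fraction expansion of `θ`:
`a_n(θ) = ⌊1 / Gⁿ(θ)⌋`. -/
def pquot (θ : ℝ) (n : ℕ) : ℕ := ⌊1 / gaussMap^[n] θ⌋₊

/-- The set `𝔼_∞` of irrational numbers in `(0,1)` all of whose partial quotients are even
and tend to infinity. -/
def Einf : Set ℝ :=
  {θ | θ ∈ Ioo (0 : ℝ) 1 ∧ Irrational θ ∧ (∀ n, Even (pquot θ n)) ∧
    Tendsto (fun n => pquot θ n) atTop atTop}

theorem volume_eq_zero_of_porous {E : Set ℝ}
    (h : ∀ x ∈ E, ∃ c > 0, ∀ ε > 0, ∃ p q p' q' : ℝ, x ∈ uIcc p q ∧ 0 < |q - p| ∧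
      |q - p| < ε ∧ p' ∈ uIcc p q ∧ q' ∈ uIcc p q ∧ c * |q - p| ≤ |q' - p'| ∧
      Disjoint (uIcc p' q') E) : volume E = 0 := by
  have key := IsUnifLocDoublingMeasure.ae_tendsto_measure_inter_div (volume : Measure ℝ) E 1
  rw [ae_iff] at key
  set N := {x | ¬ ∀ {ι : Type} {l : Filter ι} (w : ι → ℝ) (δ : ι → ℝ),
    Tendsto δ l (𝓝[>] 0) → (∀ᶠ j in l, x ∈ Metric.closedBall (w j) (1 * δ j)) →
    Tendsto (fun j => volume (E ∩ Metric.closedBall (w j) (δ j)) /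
      volume (Metric.closedBall (w j) (δ j))) l (𝓝 1)} with hN
  have hsub : E ⊆ N := by
    intro x hx hall
    obtain ⟨c, hc, hε⟩ := h x hx
    have hpos : ∀ n : ℕ, (0 : ℝ) < 1 / ((n : ℝ) + 1) := fun n => by positivity
    choose p q p' q' hxpq hpq hlt hp' hq' hcpq hdisj using fun n : ℕ => hε _ (hpos n)
    have hball : ∀ n, Metric.closedBall ((p n + q n) / 2) (|q n - p n| / 2)
        = uIcc (p n) (q n) := by
      intro n
      rw [Real.closedBall_eq_Icc, uIcc]
      rcases le_total (p n) (q n) with hle | hle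
      · rw [abs_of_nonneg (by linarith), inf_of_le_left hle, sup_of_le_right hle]
        congr 1 <;> ring
      · rw [abs_of_nonpos (by linarith), inf_of_le_right hle, sup_of_le_left hle]
        congr 1 <;> ring
    have hδ : Tendsto (fun n => |q n - p n| / 2) atTop (𝓝[>] 0) := by
      refine tendsto_nhdsWithin_iff.2 ⟨?_, Eventually.of_forall fun n => half_pos (hpq n)⟩
      refine squeeze_zero (fun n => (half_pos (hpq n)).le) (fun n => ?_)
        tendsto_one_div_add_atTop_nhds_zero_nat
      have := hlt n
      have := hpq n
      linarith
    have hlim := hall (fun n => (p n + q n) / 2) _ hδ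
      (Eventually.of_forall fun n => by rw [one_mul, hball]; exact hxpq n)
    have hbound : ∀ n, volume (E ∩ Metric.closedBall ((p n + q n) / 2) (|q n - p n| / 2)) /
      volume (Metric.closedBall ((p n + q n) / 2) (|q n - p n| / 2)) ≤ ENNReal.ofReal (1 - c) := by
      intro n
      rw [hball]
      have hsubset : uIcc (p' n) (q' n) ⊆ uIcc (p n) (q n) := uIcc_subset_uIcc (hp' n) (hq' n)
      have h1 : E ∩ uIcc (p n) (q n) ⊆ uIcc (p n) (q n) \ uIcc (p' n) (q' n) :=
        fun z hz => ⟨hz.2, fun hz' => (Set.disjoint_left.1 (hdisj n)) hz' hz.1⟩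
      refine ENNReal.div_le_of_le_mul ((measure_mono h1).trans ?_)
      rw [measure_sdiff hsubset measurableSet_uIcc.nullMeasurableSet
        (by rw [Real.volume_interval]; exact ENNReal.ofReal_ne_top), Real.volume_interval,
        Real.volume_interval, ← ENNReal.ofReal_mul' (abs_nonneg _),
        ← ENNReal.ofReal_sub _ (abs_nonneg _)]
      refine ENNReal.ofReal_le_ofReal ?_
      have := hcpq n
      linarith
    have h2 := le_of_tendsto hlim (Eventually.of_forall hbound)
    rw [ENNReal.one_le_ofReal] at h2
    linarith
  have h3 : volume (N ∩ E) ≤ 0 := (Measure.le_restrict_apply E N).trans key.le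
  rw [inter_eq_right.2 hsub] at h3
  exact le_antisymm h3 zero_le

theorem gaussMap_one_div_add {m : ℕ} (hm : 1 ≤ m) {σ : ℝ} (hσ : σ ∈ Ioo (0 : ℝ) 1) :
    gaussMap (1 / (m + σ)) = σ := by
  have hm' : (1 : ℝ) ≤ m := by exact_mod_cast hm
  have : (m : ℝ) + σ ≠ 0 := by linarith [hσ.1]
  rw [gaussMap, if_neg (one_div_ne_zero this), one_div_one_div, Int.fract_natCast_add,
    Int.fract_eq_self.2 ⟨hσ.1.le, hσ.2⟩]

theorem gaussMap_irrational {x : ℝ} (hx : x ∈ Ioo (0 : ℝ) 1) (hirr : Irrational x) :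
    gaussMap x ∈ Ioo (0 : ℝ) 1 ∧ Irrational (gaussMap x) ∧
      ∃ m : ℕ, 1 ≤ m ∧ x = 1 / (m + gaussMap x) := by
  have hg : gaussMap x = Int.fract (1 / x) := if_neg hx.1.ne'
  have hi : Irrational (1 / x) := by simpa using hirr
  have hf : Irrational (Int.fract (1 / x)) := by
    rw [Int.fract]; exact hi.sub_intCast _
  rw [hg]
  refine ⟨⟨lt_of_le_of_ne (Int.fract_nonneg _) hf.ne_zero.symm, Int.fract_lt_one _⟩, hf, ?_⟩
  have h1 : 1 ≤ 1 / x := by rw [le_div_iff₀ hx.1]; linarith [hx.2]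
  refine ⟨⌊1 / x⌋₊, by rwa [Nat.one_le_floor_iff], ?_⟩
  rw [natCast_floor_eq_intCast_floor (by linarith), Int.floor_add_fract, one_div_one_div]

theorem gaussMap_branch {x : ℝ} (hx : x ∈ Ioo (0 : ℝ) 1) (hirr : Irrational x) (n : ℕ) :
    gaussMap^[n] x ∈ Ioo (0 : ℝ) 1 ∧ Irrational (gaussMap^[n] x) ∧
      ∃ a b c d : ℝ, 1 ≤ c ∧ 0 ≤ d ∧ d ≤ c ∧ n + 1 ≤ c + d ∧ |b * c - a * d| = 1 ∧
        x = (a + b * gaussMap^[n] x) / (c + d * gaussMap^[n] x) ∧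
        ∀ σ ∈ Ioo (0 : ℝ) 1, gaussMap^[n] ((a + b * σ) / (c + d * σ)) = σ := by
  induction n with
  | zero => exact ⟨hx, hirr, 0, 1, 1, 0, by simp⟩
  | succ n ih =>
    obtain ⟨hy, hyirr, a, b, c, d, hc, hd, hdc, hn, hdet, hxeq, hbr⟩ := ih
    obtain ⟨hz, hzirr, m, hm, hyz⟩ := gaussMap_irrational hy hyirr
    rw [Function.iterate_succ_apply']
    set y := gaussMap^[n] x
    set z := gaussMap y
    have hm' : (1 : ℝ) ≤ m := by exact_mod_cast hm
    have hcm : c ≤ c * m := le_mul_of_one_le_right (by linarith) hm'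
    have hsub : ∀ σ : ℝ, 0 < σ → (a + b * (1 / (m + σ))) / (c + d * (1 / (m + σ)))
        = ((a * m + b) + a * σ) / ((c * m + d) + c * σ) := by
      intro σ hσ
      have h1 : (m : ℝ) + σ ≠ 0 := by linarith
      have h2 : c + d * (1 / (m + σ)) ≠ 0 := by positivity
      have h3 : (c * m + d) + c * σ ≠ 0 := by positivity
      field_simp
      ring
    refine ⟨hz, hzirr, a * m + b, a, c * m + d, c, by linarith, by linarith, by linarith, ?_, ?_,
      ?_, ?_⟩
    · push_cast
      linarith
    · rw [← hdet, ← abs_neg]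
      congr 1
      ring
    · rw [← hsub z hz.1, ← hyz]
      exact hxeq
    · intro σ hσ
      have h1 : (1 : ℝ) < m + σ := by linarith [hσ.1]
      rw [Function.iterate_succ_apply', ← hsub σ hσ.1, hbr _ ⟨by positivity, ?_⟩,
        gaussMap_one_div_add hm hσ]
      rw [div_lt_one (by linarith)]
      exact h1

theorem volume_gaussMap_avoiding {u v : ℝ} (hu : 0 < u) (huv : u < v) (hv : v < 1) :
    volume {x | x ∈ Ioo (0 : ℝ) 1 ∧ Irrational x ∧ ∀ n, gaussMap^[n] x ∉ Icc u v} = 0 := by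
  refine volume_eq_zero_of_porous fun x ⟨hx, hirr, _⟩ => ⟨(v - u) / 2, by linarith, ?_⟩
  intro ε hε
  obtain ⟨n, hnε⟩ := exists_nat_one_div_lt hε
  obtain ⟨hy, -, a, b, c, d, hc, hd, hdc, hn, hdet, hxeq, hbr⟩ := gaussMap_branch hx hirr n
  set y := gaussMap^[n] x
  set f : ℝ → ℝ := fun σ => (a + b * σ) / (c + d * σ) with hf
  have hden : ∀ σ, 0 ≤ σ → 0 < c + d * σ := fun σ hσ => by positivity
  have hsdiff : ∀ s t, 0 ≤ s → 0 ≤ t →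
      f t - f s = (b * c - a * d) * (t - s) / ((c + d * s) * (c + d * t)) := by
    intro s t hs ht
    have h1 := hden s hs
    have h2 := hden t ht
    simp only [hf]
    field_simp
    ring
  have hdiff : ∀ s t, 0 ≤ s → 0 ≤ t →
      |f t - f s| = |t - s| / ((c + d * s) * (c + d * t)) := by
    intro s t hs ht
    rw [hsdiff s t hs ht, abs_div, abs_mul, hdet, one_mul,
      abs_of_pos (mul_pos (hden s hs) (hden t ht))]
  have hcont : ContinuousOn f (Icc 0 1) := by
    refine ContinuousOn.div (by fun_prop) (by fun_prop) fun σ hσ => (hden σ hσ.1).ne'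
  have hmem : ∀ σ ∈ Icc (0 : ℝ) 1, f σ ∈ uIcc (f 0) (f 1) := by
    intro σ hσ
    have h1 := hsdiff 0 σ le_rfl hσ.1
    have h2 := hsdiff σ 1 hσ.1 zero_le_one
    rw [sub_zero, mul_zero, add_zero] at h1
    rw [mul_one] at h2
    have h3 := hden σ hσ.1
    have h4 := hσ.1
    have h5 : 0 ≤ 1 - σ := by linarith [hσ.2]
    rw [mem_uIcc]
    rcases le_total 0 (b * c - a * d) with h | h
    · left
      constructor
      · rw [← sub_nonneg, h1]; positivity
      · rw [← sub_nonneg, h2]; positivity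
    · right
      have h' : 0 ≤ -(b * c - a * d) := by linarith
      constructor
      · rw [← sub_nonneg, ← neg_sub, h2, ← neg_div, ← neg_mul]; positivity
      · rw [← sub_nonneg, ← neg_sub, h1, ← neg_div, ← neg_mul]; positivity
  have hlen : |f 1 - f 0| = 1 / (c * (c + d)) := by
    rw [hdiff 0 1 le_rfl zero_le_one]; simp
  refine ⟨f 0, f 1, f u, f v, ?_, ?_, ?_, hmem u ⟨hu.le, by linarith⟩,
    hmem v ⟨by linarith, hv.le⟩, ?_, ?_⟩
  · rw [hxeq]; exact hmem y ⟨hy.1.le, hy.2.le⟩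
  · rw [hlen]; positivity
  · rw [hlen]
    refine lt_of_le_of_lt (one_div_le_one_div_of_le (by positivity) ?_) hnε
    nlinarith
  · rw [hlen, hdiff u v hu.le (by linarith), abs_of_pos (by linarith : 0 < v - u), div_mul_div_comm,
      mul_one]
    refine div_le_div_of_nonneg_left (by linarith) (mul_pos (hden u hu.le) (hden v (by linarith))) ?_
    have h1 : c + d * u ≤ c + d := by nlinarith
    have h2 : c + d * v ≤ 2 * c := by nlinarith
    nlinarith [mul_le_mul h1 h2 (hden v (by linarith)).le (by linarith)]
  · rw [Set.disjoint_left]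
    rintro z hz ⟨-, -, hz'⟩
    obtain ⟨w, hw, rfl⟩ := intermediate_value_uIcc
      (hcont.mono (by rw [uIcc_of_le huv.le]; exact Icc_subset_Icc hu.le hv.le)) hz
    rw [uIcc_of_le huv.le] at hw
    refine hz' n ?_
    rw [hbr w ⟨by linarith [hw.1], by linarith [hw.2]⟩]
    exact hw

theorem ae_frequently_gaussMap_mem :
    ∀ᵐ x ∂(volume : Measure ℝ), x ∈ Ioo (0 : ℝ) 1 → Irrational x ∧
      ∀ u v : ℝ, 0 < u → u < v → v < 1 → ∃ᶠ n in atTop, gaussMap^[n] x ∈ Ioo u v := by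
  have hirr : ∀ᵐ x ∂(volume : Measure ℝ), Irrational x := by
    rw [ae_iff]
    refine (Set.countable_range ((↑) : ℚ → ℝ)).mono ?_ |>.measure_zero _
    intro x hx
    simpa [Irrational] using hx
  have hall : ∀ᵐ x ∂(volume : Measure ℝ), ∀ r s : ℚ, 0 < r → r < s → s < 1 →
      x ∈ Ioo (0 : ℝ) 1 → Irrational x → ∃ n, gaussMap^[n] x ∈ Icc (r : ℝ) s := by
    refine ae_all_iff.2 fun r => ae_all_iff.2 fun s => ?_
    by_cases h : 0 < r ∧ r < s ∧ s < 1
    · have := volume_gaussMap_avoiding (u := r) (v := s) (by exact_mod_cast h.1)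
        (by exact_mod_cast h.2.1) (by exact_mod_cast h.2.2)
      rw [ae_iff]
      refine measure_mono_null ?_ this
      intro x hx
      simp only [mem_ofPred_eq] at hx ⊢
      push Not at hx
      exact ⟨hx.2.2.2.1, hx.2.2.2.2.1, hx.2.2.2.2.2⟩
    · exact Eventually.of_forall fun x h1 h2 h3 => absurd ⟨h1, h2, h3⟩ h
  filter_upwards [hirr, hall] with x hx hx' h01
  refine ⟨hx, fun u v hu huv hv => ?_⟩
  rw [Nat.frequently_atTop_iff_infinite]
  intro hfin
  have hF : ((fun n => gaussMap^[n] x) '' {n | gaussMap^[n] x ∈ Ioo u v}).Finite := hfin.image _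
  have hopen : IsOpen (Ioo u v \ ((fun n => gaussMap^[n] x) '' {n | gaussMap^[n] x ∈ Ioo u v})) :=
    isOpen_Ioo.sdiff hF.isClosed
  have hne : (Ioo u v \ ((fun n => gaussMap^[n] x) '' {n | gaussMap^[n] x ∈ Ioo u v})).Nonempty :=
    ((Ioo_infinite huv).sdiff hF).nonempty
  obtain ⟨y, hy⟩ := hne
  obtain ⟨l, r, hlr, hsub⟩ := mem_nhds_iff_exists_Ioo_subset.1 (hopen.mem_nhds hy)
  obtain ⟨s, hs1, hs2⟩ := exists_rat_btwn hlr.1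
  obtain ⟨t, ht1, ht2⟩ := exists_rat_btwn hlr.2
  have hIcc : Icc (s : ℝ) t ⊆ Ioo l r := Icc_subset_Ioo hs1 ht2
  have hsm := (hsub (hIcc ⟨le_rfl, (hs2.trans ht1).le⟩)).1
  have htm := (hsub (hIcc ⟨(hs2.trans ht1).le, le_rfl⟩)).1
  obtain ⟨n, hn⟩ := hx' s t (by exact_mod_cast hu.trans hsm.1) (by exact_mod_cast hs2.trans ht1)
    (by exact_mod_cast htm.2.trans hv) h01 hx
  have := hsub (hIcc hn)
  exact this.2 ⟨n, this.1, rfl⟩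

theorem prod_gaussMap_le {x : ℝ} (hx : x ∈ Ioo (0 : ℝ) 1) (hirr : Irrational x) (n : ℕ) :
    ∏ i ∈ Finset.range n, gaussMap^[i] x ≤ (1 / 2) ^ (n / 2) := by
  have hmem := fun i => (gaussMap_branch hx hirr i).1
  induction n using Nat.twoStepInduction with
  | zero => simp
  | one => simpa using hx.2.le
  | more n ih _ =>
    rw [Finset.prod_range_succ, Finset.prod_range_succ, mul_assoc,
      show (n + 2) / 2 = n / 2 + 1 by omega, pow_succ]
    obtain ⟨-, hi, -⟩ := gaussMap_branch hx hirr n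
    obtain ⟨hz, -, m, hm, hy⟩ := gaussMap_irrational (hmem n) hi
    have hm' : (1 : ℝ) ≤ m := by exact_mod_cast hm
    rw [Function.iterate_succ_apply']
    have hy0 := hmem n
    set y := gaussMap^[n] x
    set z := gaussMap y
    have h1 : y * (m + z) = 1 := by
      rw [hy]; exact one_div_mul_cancel (by linarith [hz.1])
    refine mul_le_mul ih ?_ (mul_nonneg hy0.1.le hz.1.le) (by positivity)
    nlinarith [hy0.1, hy0.2, hz.1, hz.2]

theorem mul_gaussMap {x : ℝ} (hx : 0 < x) : x * gaussMap x = 1 - ⌊1 / x⌋ * x := by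
  rw [gaussMap, if_neg hx.ne', Int.fract, mul_sub, mul_one_div_cancel hx.ne', mul_comm x]

theorem fiberMap_of_nonpos {ρ α : ℝ} (hρ : 0 < ρ) (hα : α ≤ 0) : fiberMap ρ α = -α := by
  rw [fiberMap, if_neg hρ.ne', if_pos hα]

theorem fiberMap_of_le {ρ α : ℝ} (hρ : 0 < ρ) (hα : 0 < α) (h : α ≤ ρ * gaussMap ρ) :
    fiberMap ρ α = -α / (ρ * gaussMap ρ) := by
  rw [fiberMap, if_neg hρ.ne', if_neg hα.not_ge, if_pos h]

theorem fiberMap_of_gt {ρ α : ℝ} (hρ : 0 < ρ) (hα : 0 < α) (h : ρ * gaussMap ρ < α) :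
    fiberMap ρ α = Int.fract ((1 - α) / ρ) := by
  rw [fiberMap, if_neg hρ.ne', if_neg hα.not_ge, if_neg h.not_ge]

theorem fiberMap_negative_branch {ρ w : ℝ} (hρ : 0 < ρ) (hG : 0 < gaussMap ρ)
    (hw : w ∈ Ioo (-1 : ℝ) 0) : fiberMap ρ (-(w * (ρ * gaussMap ρ))) = w := by
  have h := mul_pos hρ hG
  rw [fiberMap_of_le hρ (by nlinarith [hw.2]) (by nlinarith [hw.1]), neg_neg,
    mul_div_cancel_right₀ _ h.ne']

theorem fiberMap_positive_branch {ρ w : ℝ} {k : ℤ} (hρ : 0 < ρ) (hG : 0 < gaussMap ρ)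
    (hk : k < ⌊1 / ρ⌋) (hw : w ∈ Ioo (0 : ℝ) 1) : fiberMap ρ (1 - (k + w) * ρ) = w := by
  have h := mul_pos hρ hG
  have hk' : (k : ℝ) + 1 ≤ ⌊1 / ρ⌋ := by exact_mod_cast hk
  have h1 : ρ * gaussMap ρ < 1 - (k + w) * ρ := by
    rw [mul_gaussMap hρ]
    nlinarith [hw.2]
  rw [fiberMap_of_gt hρ (h.trans h1) h1, sub_sub_cancel, mul_div_cancel_right₀ _ hρ.ne',
    Int.fract_intCast_add, Int.fract_eq_self.2 ⟨hw.1.le, hw.2⟩]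

theorem skewProd_iterate_fst (p : ℝ × ℝ) (n : ℕ) :
    (skewProd^[n] p).1 = gaussMap^[n] p.1 := by
  induction n with
  | zero => rfl
  | succ n ih => rw [Function.iterate_succ_apply', Function.iterate_succ_apply', ← ih]; rfl

/-- Points in the interior of the domains of the branches of the skew product. -/
def RegularPoint (p : ℝ × ℝ) : Prop :=
  p.1 ∈ Ioo (0 : ℝ) 1 ∧ Irrational p.1 ∧ p.2 ∈ Ioo (-1 : ℝ) 1 ∧ p.2 ≠ 0 ∧
    ∀ k : ℤ, p.2 ≠ 1 - k * p.1

theorem RegularPoint.ne_mul_gaussMap {p : ℝ × ℝ} (hp : RegularPoint p) :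
    p.2 ≠ p.1 * gaussMap p.1 := by
  rw [mul_gaussMap hp.1.1]; exact hp.2.2.2.2 _

theorem RegularPoint.sub_div_ne {p : ℝ × ℝ} (hp : RegularPoint p) (k : ℤ) :
    (1 - p.2) / p.1 ≠ k := by
  intro h
  rw [div_eq_iff hp.1.1.ne'] at h
  exact hp.2.2.2.2 k (by linarith)

theorem RegularPoint.fiberMap_mem {p : ℝ × ℝ} (hp : RegularPoint p) :
    fiberMap p.1 p.2 ∈ Ioo (-1 : ℝ) 1 := by
  have hρ := hp.1.1
  obtain ⟨hG, -, -⟩ := gaussMap_irrational hp.1 hp.2.1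
  have hpos := mul_pos hρ hG.1
  rcases lt_or_gt_of_ne hp.2.2.2.1 with h | h
  · rw [fiberMap_of_nonpos hρ h.le]
    exact ⟨by linarith, by linarith [hp.2.2.1.1]⟩
  · rcases lt_or_gt_of_ne hp.ne_mul_gaussMap with h' | h'
    · rw [fiberMap_of_le hρ h h'.le, mem_Ioo, lt_div_iff₀ hpos, div_lt_iff₀ hpos]
      exact ⟨by linarith, by linarith⟩
    · rw [fiberMap_of_gt hρ h h']
      exact ⟨by linarith [Int.fract_nonneg ((1 - p.2) / p.1)], Int.fract_lt_one _⟩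

theorem exists_fiber_branch {ρ x : ℝ} (hreg : ∀ n, RegularPoint (skewProd^[n] (ρ, x))) (n : ℕ) :
    ∃ a b e : ℝ, (e = 0 ∨ e = -1) ∧ (skewProd^[n] (ρ, x)).2 ∈ Ioo e (e + 1) ∧ b ≠ 0 ∧
      |b| * ρ ≤ ∏ i ∈ Finset.range n, gaussMap^[i] ρ ∧
      (e = -1 → |b| * ρ ≤ ∏ i ∈ Finset.range (n + 1), gaussMap^[i] ρ) ∧
      x = a + b * (skewProd^[n] (ρ, x)).2 ∧
      ∀ w ∈ Ioo e (e + 1), skewProd^[n] (ρ, a + b * w) = (gaussMap^[n] ρ, w) := by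
  have hρ : ρ ∈ Ioo (0 : ℝ) 1 := (hreg 0).1
  have hirr : Irrational ρ := (hreg 0).2.1
  induction n with
  | zero =>
    obtain ⟨-, -, hx, hx0, -⟩ := hreg 0
    simp only [Function.iterate_zero, id_eq] at hx hx0
    rcases lt_or_gt_of_ne hx0 with h | h
    · exact ⟨0, 1, -1, Or.inr rfl, by simpa using ⟨hx.1, h⟩, one_ne_zero, by simpa using hρ.2.le,
        by simp, by simp, by simp⟩
    · exact ⟨0, 1, 0, Or.inl rfl, by simpa using ⟨h, hx.2⟩, one_ne_zero, by simpa using hρ.2.le,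
        by simp, by simp, by simp⟩
  | succ n ih =>
    obtain ⟨a, b, e, he, hy, hb, hbπ, hbπ', hx, hbr⟩ := ih
    have hr := hreg n
    have hfst := skewProd_iterate_fst (ρ, x) n
    obtain ⟨hG, -, -⟩ := gaussMap_irrational hr.1 hr.2.1
    have hne := hr.ne_mul_gaussMap
    have hnk := hr.sub_div_ne
    have hσ := hr.1
    have hπ : 0 ≤ ∏ i ∈ Finset.range n, gaussMap^[i] ρ :=
      Finset.prod_nonneg fun i _ => (gaussMap_branch hρ hirr i).1.1.le
    simp only [Finset.prod_range_succ _ (n + 1), Finset.prod_range_succ _ n,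
      Function.iterate_succ_apply', skewProd] at hbπ' ⊢
    simp only [hfst] at hσ hG hne hnk ⊢
    set σ := gaussMap^[n] ρ
    set y := (skewProd^[n] (ρ, x)).2
    have hpos := mul_pos hσ.1 hG.1
    rcases he with rfl | rfl
    · rw [zero_add] at hy hbr
      rcases lt_or_gt_of_ne hne with h | h
      · rw [fiberMap_of_le hσ.1 hy.1 h.le]
        have hbound : |-(b * (σ * gaussMap σ))| * ρ ≤
            (∏ i ∈ Finset.range n, gaussMap^[i] ρ) * σ * gaussMap σ := by
          rw [abs_neg, abs_mul, abs_of_pos hpos]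
          nlinarith [mul_le_mul_of_nonneg_right hbπ hpos.le]
        refine ⟨a, -(b * (σ * gaussMap σ)), -1, Or.inr rfl, ?_, ?_, ?_, fun _ => hbound, ?_, ?_⟩
        · rw [mem_Ioo, lt_div_iff₀ hpos, div_lt_iff₀ hpos]
          exact ⟨by linarith, by linarith [hy.1]⟩
        · exact neg_ne_zero.2 (mul_ne_zero hb hpos.ne')
        · exact hbound.trans (mul_le_of_le_one_right (mul_nonneg hπ hσ.1.le) hG.2.le)
        · rw [neg_mul, mul_assoc, mul_div_cancel₀ _ hpos.ne', mul_neg, neg_neg]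
          exact hx
        · intro w hw
          have hw' : w ∈ Ioo (-1 : ℝ) 0 := by simpa using hw
          have hmem : -(w * (σ * gaussMap σ)) ∈ Ioo (0 : ℝ) 1 := by
            refine ⟨by nlinarith [hw'.2], ?_⟩
            have := mul_lt_one_of_nonneg_of_lt_one_left hσ.1.le hσ.2 hG.2.le
            nlinarith [hw'.1]
          have := hbr _ hmem
          rw [show a + -(b * (σ * gaussMap σ)) * w = a + b * -(w * (σ * gaussMap σ)) by ring, this,
            fiberMap_negative_branch hσ.1 hG.1 hw']
      · rw [fiberMap_of_gt hσ.1 hy.1 h]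
        set k := ⌊(1 - y) / σ⌋ with hk
        have hyk : y = 1 - (k + Int.fract ((1 - y) / σ)) * σ := by
          rw [hk, Int.floor_add_fract, div_mul_cancel₀ _ hσ.1.ne']
          ring
        have hkN : k < ⌊1 / σ⌋ := by
          rw [mul_gaussMap hσ.1] at h
          have : (1 - y) / σ < ⌊1 / σ⌋ := by
            rw [div_lt_iff₀ hσ.1]; linarith
          exact_mod_cast (Int.floor_le _).trans_lt this
        have hk0 : 0 ≤ k := Int.floor_nonneg.2 (div_nonneg (by linarith [hy.2]) hσ.1.le)
        have hk0' : (0 : ℝ) ≤ k := by exact_mod_cast hk0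
        refine ⟨a + b * (1 - k * σ), -(b * σ), 0, Or.inl rfl, ?_, ?_, ?_, ?_, ?_, ?_⟩
        · rw [zero_add]
          exact ⟨Int.fract_pos.2 (hnk _), Int.fract_lt_one _⟩
        · exact neg_ne_zero.2 (mul_ne_zero hb hσ.1.ne')
        · rw [abs_neg, abs_mul, abs_of_pos hσ.1]
          nlinarith [mul_le_mul_of_nonneg_right hbπ hσ.1.le]
        · intro h0
          norm_num at h0
        · rw [hx]
          nth_rewrite 1 [hyk]
          ring
        · intro w hw
          rw [zero_add] at hw
          have hmem : 1 - (k + w) * σ ∈ Ioo (0 : ℝ) 1 := by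
            have h1 : (k : ℝ) + 1 ≤ ⌊1 / σ⌋ := by exact_mod_cast hkN
            rw [mul_gaussMap hσ.1] at hpos
            constructor
            · nlinarith [hw.2, hσ.1]
            · have := mul_pos (add_pos_of_nonneg_of_pos hk0' hw.1) hσ.1
              linarith
          have := hbr _ hmem
          rw [show a + b * (1 - k * σ) + -(b * σ) * w = a + b * (1 - (k + w) * σ) by ring, this,
            fiberMap_positive_branch hσ.1 hG.1 hkN hw]
    · have hy' : y ∈ Ioo (-1 : ℝ) 0 := by simpa using hy
      rw [fiberMap_of_nonpos hσ.1 hy'.2.le]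
      refine ⟨a, -b, 0, Or.inl rfl, ?_, neg_ne_zero.2 hb, ?_, ?_, ?_, ?_⟩
      · exact ⟨by linarith [hy'.2], by linarith [hy'.1]⟩
      · rw [abs_neg]
        exact hbπ' rfl
      · intro h0
        norm_num at h0
      · rw [hx]
        ring
      · intro w hw
        have := hbr (-w) ⟨by linarith [hw.2], by linarith [hw.1]⟩
        rw [show a + -b * w = a + b * -w by ring, this, fiberMap_of_nonpos hσ.1 (by linarith [hw.1]),
          neg_neg]

theorem exists_branch_onto_upper {σ e : ℝ} (hσ : σ ∈ Ioo (0 : ℝ) 1) (hirr : Irrational σ)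
    (he : e = 0 ∨ e = -1) : ∃ a b : ℝ, σ ≤ |b| ∧
      ∀ w ∈ Ioo (0 : ℝ) 1, a + b * w ∈ Ioo e (e + 1) ∧
        skewProd (σ, a + b * w) = (gaussMap σ, w) := by
  obtain ⟨hG, -, -⟩ := gaussMap_irrational hσ hirr
  rcases he with rfl | rfl
  · refine ⟨1, -σ, by rw [abs_neg, abs_of_pos hσ.1], fun w hw => ⟨?_, ?_⟩⟩
    · constructor <;> nlinarith [hw.1, hw.2, hσ.1, hσ.2]
    · have h1 : 1 ≤ 1 / σ := by rw [le_div_iff₀ hσ.1]; linarith [hσ.2]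
      have := fiberMap_positive_branch (k := 0) hσ.1 hG.1
        (Int.lt_iff_add_one_le.2 (Int.le_floor.2 (by simpa using h1))) hw
      rw [skewProd, show (1 + -σ * w : ℝ) = 1 - (((0 : ℤ) : ℝ) + w) * σ by push_cast; ring, this]
  · refine ⟨0, -1, by rw [abs_neg, abs_one]; exact hσ.2.le, fun w hw => ⟨?_, ?_⟩⟩
    · exact ⟨by linarith [hw.2], by linarith [hw.1]⟩
    · rw [skewProd, fiberMap_of_nonpos hσ.1 (by simpa using hw.1.le)]
      simp

theorem exists_branch_from_upper {σ e : ℝ} (hσ : σ ∈ Ioo (0 : ℝ) 1) (hirr : Irrational σ)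
    (he : e = 0 ∨ e = -1) : ∃ a b : ℝ, σ * gaussMap σ ≤ |b| ∧
      ∀ w ∈ Ioo e (e + 1), a + b * w ∈ Ioo (0 : ℝ) 1 ∧
        skewProd (σ, a + b * w) = (gaussMap σ, w) := by
  obtain ⟨hG, -, -⟩ := gaussMap_irrational hσ hirr
  have hpos := mul_pos hσ.1 hG.1
  rcases he with rfl | rfl
  · obtain ⟨a, b, hb, h⟩ := exists_branch_onto_upper hσ hirr (Or.inl rfl)
    refine ⟨a, b, (mul_le_of_le_one_right hσ.1.le hG.2.le).trans hb, ?_⟩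
    simpa using h
  · refine ⟨0, -(σ * gaussMap σ), by rw [abs_neg, abs_of_pos hpos], fun w hw => ?_⟩
    have hw' : w ∈ Ioo (-1 : ℝ) 0 := by simpa using hw
    rw [show 0 + -(σ * gaussMap σ) * w = -(w * (σ * gaussMap σ)) by ring, skewProd,
      fiberMap_negative_branch hσ.1 hG.1 hw']
    refine ⟨⟨by nlinarith [hw'.2], ?_⟩, rfl⟩
    nlinarith [hw'.1, hσ.1, hσ.2, hG.1, hG.2]

theorem exists_two_step_branch {σ e e' : ℝ} (hσ : σ ∈ Ioo (0 : ℝ) 1) (hirr : Irrational σ)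
    (he : e = 0 ∨ e = -1) (he' : e' = 0 ∨ e' = -1) :
    ∃ a b : ℝ, σ * (gaussMap σ * gaussMap (gaussMap σ)) ≤ |b| ∧
      ∀ w ∈ Ioo e' (e' + 1), a + b * w ∈ Ioo e (e + 1) ∧
        skewProd^[2] (σ, a + b * w) = (gaussMap (gaussMap σ), w) := by
  obtain ⟨hG, hGirr, -⟩ := gaussMap_irrational hσ hirr
  obtain ⟨hG2, -, -⟩ := gaussMap_irrational hG hGirr
  obtain ⟨a, b, hb, h⟩ := exists_branch_onto_upper hσ hirr he
  obtain ⟨a', b', hb', h'⟩ := exists_branch_from_upper hG hGirr he'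
  refine ⟨a + b * a', b * b', ?_, fun w hw => ?_⟩
  · rw [abs_mul]
    exact mul_le_mul hb hb' (mul_pos hG.1 hG2.1).le (abs_nonneg _)
  · obtain ⟨h1, h2⟩ := h' w hw
    obtain ⟨h3, h4⟩ := h _ h1
    rw [show a + b * a' + b * b' * w = a + b * (a' + b' * w) by ring]
    refine ⟨h3, ?_⟩
    rw [Function.iterate_succ_apply, h4, Function.iterate_one, h2]

theorem affine_mem_uIcc {a b s t w : ℝ} (hw : w ∈ Icc s t) :
    a + b * w ∈ uIcc (a + b * s) (a + b * t) := by
  rw [mem_uIcc]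
  rcases le_total 0 b with h | h
  · exact Or.inl ⟨by nlinarith [hw.1], by nlinarith [hw.2]⟩
  · exact Or.inr ⟨by nlinarith [hw.2], by nlinarith [hw.1]⟩

theorem gaussMap_two_step {r s σ : ℝ} (hr : 0 < r) (hs : s < 1)
    (hσ : σ ∈ Ioo ((1 + r) / (2 + r)) ((1 + s) / (2 + s))) (hrs : r < s) :
    gaussMap (gaussMap σ) ∈ Ioo r s ∧ 1 / 2 ≤ σ ∧ 1 / 2 ≤ gaussMap σ := by
  have h1 := hσ.1
  have h2 := hσ.2
  rw [div_lt_iff₀ (by linarith)] at h1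
  rw [lt_div_iff₀ (by linarith)] at h2
  have hσ2 : 1 / 2 < σ := by nlinarith
  have hσ1 : σ < 1 := by nlinarith
  set τ := 1 / σ - 1 with hτ
  have hστ : σ = 1 / (1 + τ) := by rw [hτ]; simp
  have hστ' : σ * (1 + τ) = 1 := by rw [hτ]; field_simp; ring
  have hτ1 : τ < 1 := by nlinarith
  have hτ0 : 1 / 2 < τ := by
    by_contra hcon
    nlinarith
  set υ := 1 / τ - 1 with hυ
  have hτυ : τ = 1 / (1 + υ) := by rw [hυ]; simp
  have hτυ' : τ * (1 + υ) = 1 := by rw [hυ]; field_simp; ring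
  have hσυ : σ * (2 + υ) = 1 + υ := by
    have : τ * (σ * (2 + υ) - (1 + υ)) = 0 := by linear_combination (σ - 1) * hτυ' + hστ'
    have := (mul_eq_zero.1 this).resolve_left (by linarith)
    linarith
  have hυr : r < υ := by
    by_contra hcon
    nlinarith
  have hυs : υ < s := by
    by_contra hcon
    nlinarith
  have hGσ : gaussMap σ = τ := by
    have := gaussMap_one_div_add (m := 1) le_rfl (σ := τ) ⟨by linarith, hτ1⟩
    rwa [Nat.cast_one, ← hστ] at this
  have hGτ : gaussMap τ = υ := by
    have := gaussMap_one_div_add (m := 1) le_rfl (σ := υ) ⟨by linarith, by linarith⟩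
    rwa [Nat.cast_one, ← hτυ] at this
  rw [hGσ, hGτ]
  exact ⟨⟨hυr, hυs⟩, hσ2.le, hτ0.le⟩

theorem volume_fiber_avoiding {ρ r s u v e' : ℝ} (hr : 0 < r) (hrs : r < s) (hs : s < 1)
    (he' : e' = 0 ∨ e' = -1) (hu : e' < u) (huv : u < v) (hv : v < e' + 1)
    (hρ : ∃ᶠ n in atTop, gaussMap^[n] ρ ∈ Ioo ((1 + r) / (2 + r)) ((1 + s) / (2 + s))) :
    volume {x | (∀ n, RegularPoint (skewProd^[n] (ρ, x))) ∧
      ∀ n, skewProd^[n] (ρ, x) ∉ Ioo r s ×ˢ Icc u v} = 0 := by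
  refine volume_eq_zero_of_porous fun x ⟨hreg, _⟩ => ⟨r / 4 * (v - u), by
    have := sub_pos.2 huv
    positivity, fun ε hε => ?_⟩
  have hρ01 : ρ ∈ Ioo (0 : ℝ) 1 := (hreg 0).1
  have hirr : Irrational ρ := (hreg 0).2.1
  have hlim : Tendsto (fun n : ℕ => ((1 : ℝ) / 2) ^ (n / 2)) atTop (𝓝 0) :=
    (tendsto_pow_atTop_nhds_zero_of_lt_one (by norm_num) (by norm_num)).comp
      (Nat.tendsto_div_const_atTop two_ne_zero)
  obtain ⟨n, hn, hsmall⟩ :=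
    (hρ.and_eventually (hlim.eventually (gt_mem_nhds (mul_pos hε hρ01.1)))).exists
  obtain ⟨a, b, e, he, hy, hb, hbπ, -, hx, hbr⟩ := exists_fiber_branch hreg n
  obtain ⟨hσ, hσirr, -⟩ := gaussMap_branch hρ01 hirr n
  obtain ⟨hG2, hσ2, hG1⟩ := gaussMap_two_step hr hs hn hrs
  obtain ⟨a', b', hb', hbr'⟩ := exists_two_step_branch hσ hσirr he he'
  set σ := gaussMap^[n] ρ
  have hslope : r / 4 ≤ |b'| := by
    refine le_trans ?_ hb'
    have : 1 / 2 * r ≤ gaussMap σ * gaussMap (gaussMap σ) :=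
      mul_le_mul hG1 hG2.1.le hr.le (by linarith)
    have := mul_le_mul hσ2 this (by positivity) (by linarith)
    linarith
  have hmem : ∀ w ∈ Ioo e' (e' + 1),
      a + b * (a' + b' * w) ∈ uIcc (a + b * e) (a + b * (e + 1)) := fun w hw =>
    affine_mem_uIcc (Ioo_subset_Icc_self (hbr' w hw).1)
  have hlen : |a + b * (e + 1) - (a + b * e)| = |b| := by
    congr 1
    ring
  refine ⟨a + b * e, a + b * (e + 1), a + b * (a' + b' * u), a + b * (a' + b' * v), ?_, ?_, ?_,
    hmem u ⟨hu, by linarith⟩, hmem v ⟨by linarith, hv⟩, ?_, ?_⟩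
  · rw [hx]
    exact affine_mem_uIcc (Ioo_subset_Icc_self hy)
  · rw [hlen]
    exact abs_pos.2 hb
  · rw [hlen]
    have := (hbπ.trans (prod_gaussMap_le hρ01 hirr n)).trans_lt hsmall
    exact lt_of_mul_lt_mul_right this hρ01.1.le
  · rw [hlen, show a + b * (a' + b' * v) - (a + b * (a' + b' * u)) = b' * (v - u) * b by ring,
      abs_mul, abs_mul, abs_of_pos (sub_pos.2 huv)]
    have := (sub_pos.2 huv).le
    gcongr
  · rw [Set.disjoint_left]
    rintro z hz ⟨-, hz'⟩
    obtain ⟨w, hw, rfl⟩ := intermediate_value_uIcc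
      (f := fun w => a + b * (a' + b' * w)) (by fun_prop) hz
    rw [uIcc_of_le huv.le] at hw
    obtain ⟨h1, h2⟩ := hbr' w ⟨by linarith [hw.1], by linarith [hw.2]⟩
    refine hz' (2 + n) ?_
    rw [Function.iterate_add_apply]
    simp only [hbr _ h1, h2]
    exact ⟨hG2, hw⟩

theorem countable_fiberMap_preimage {ρ : ℝ} (hρ : ρ ∈ Ioo (0 : ℝ) 1) (hirr : Irrational ρ)
    {S : Set ℝ} (hS : S.Countable) : {α | fiberMap ρ α ∈ S}.Countable := by
  obtain ⟨hG, -, -⟩ := gaussMap_irrational hρ hirr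
  have hpos := mul_pos hρ.1 hG.1
  have h1 := hS.image (fun β => -β)
  have h2 := hS.image (fun β => -(β * (ρ * gaussMap ρ)))
  have h3 : (⋃ k : ℤ, (fun β => 1 - (k + β) * ρ) '' S).Countable :=
    countable_iUnion fun k => hS.image _
  refine ((h1.union h2).union h3).mono fun α hα => ?_
  rw [Set.mem_ofPred_eq] at hα
  rcases le_or_gt α 0 with h | h
  · exact Or.inl (Or.inl ⟨_, hα, by simp only [fiberMap_of_nonpos hρ.1 h, neg_neg]⟩)
  · rcases le_or_gt α (ρ * gaussMap ρ) with h' | h'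
    · refine Or.inl (Or.inr ⟨_, hα, ?_⟩)
      simp only [fiberMap_of_le hρ.1 h h', div_mul_cancel₀ _ hpos.ne', neg_neg]
    · refine Or.inr (mem_iUnion.2 ⟨⌊(1 - α) / ρ⌋, _, hα, ?_⟩)
      simp only [fiberMap_of_gt hρ.1 h h', Int.floor_add_fract, div_mul_cancel₀ _ hρ.1.ne']
      ring

theorem countable_skewProd_iterate_preimage {ρ : ℝ} (hρ : ρ ∈ Ioo (0 : ℝ) 1)
    (hirr : Irrational ρ) (n : ℕ) {S : Set ℝ} (hS : S.Countable) :
    {α | (skewProd^[n] (ρ, α)).2 ∈ S}.Countable := by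
  induction n generalizing S with
  | zero => exact hS
  | succ n ih =>
    obtain ⟨hσ, hσirr, -⟩ := gaussMap_branch hρ hirr n
    refine (ih (countable_fiberMap_preimage hσ hσirr hS)).mono fun α hα => ?_
    rw [Set.mem_ofPred_eq, Function.iterate_succ_apply', skewProd, skewProd_iterate_fst] at hα
    exact hα

theorem countable_not_regular {ρ : ℝ} (hρ : ρ ∈ Ioo (0 : ℝ) 1) (hirr : Irrational ρ) :
    {α | α ∈ Ioo (-1 : ℝ) 1 ∧ ¬ ∀ n, RegularPoint (skewProd^[n] (ρ, α))}.Countable := by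
  have hC : (⋃ n : ℕ, {α | (skewProd^[n] (ρ, α)).2 ∈
      insert (0 : ℝ) (range fun k : ℤ => 1 - k * gaussMap^[n] ρ)}).Countable :=
    countable_iUnion fun n => countable_skewProd_iterate_preimage hρ hirr n
      ((countable_range _).insert _)
  refine hC.mono fun α ⟨hα, hnot⟩ => ?_
  by_contra hcon
  simp only [mem_iUnion, not_exists, Set.mem_ofPred_eq, mem_insert_iff, not_or, mem_range] at hcon
  refine hnot fun n => ?_
  have hreg : ∀ n, (skewProd^[n] (ρ, α)).2 ∈ Ioo (-1 : ℝ) 1 →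
      RegularPoint (skewProd^[n] (ρ, α)) := by
    intro n hn
    obtain ⟨hσ, hσirr, -⟩ := gaussMap_branch hρ hirr n
    refine ⟨?_, ?_, hn, (hcon n).1, fun k hk => (hcon n).2 k ?_⟩
    · rwa [skewProd_iterate_fst]
    · rwa [skewProd_iterate_fst]
    · rw [hk, skewProd_iterate_fst]
  induction n with
  | zero => exact hreg 0 hα
  | succ n ih =>
    refine hreg (n + 1) ?_
    rw [Function.iterate_succ_apply']
    exact ih.fiberMap_mem

theorem RegularPoint.continuousAt {p : ℝ × ℝ} (hp : RegularPoint p) :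
    ContinuousAt skewProd p := by
  have hρ := hp.1.1
  obtain ⟨hG, hGirr, -⟩ := gaussMap_irrational hp.1 hp.2.1
  have hpos := mul_pos hρ hG.1
  have hevρ : ∀ᶠ q : ℝ × ℝ in 𝓝 p, 0 < q.1 := continuousAt_fst.eventually (lt_mem_nhds hρ)
  have hgauss : ContinuousAt (fun q : ℝ × ℝ => gaussMap q.1) p := by
    have h1 : ContinuousAt (fun q : ℝ × ℝ => Int.fract (1 / q.1)) p := by
      refine ContinuousAt.comp (g := Int.fract) (f := fun q : ℝ × ℝ => 1 / q.1)
        (continuousAt_fract ?_) (continuousAt_const.div continuousAt_fst hρ.ne')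
      have : Irrational (1 / p.1) := by simpa using hp.2.1
      exact this.ne_int _
    refine h1.congr ?_
    filter_upwards [hevρ] with q hq
    rw [gaussMap, if_neg hq.ne']
  have hmul : ContinuousAt (fun q : ℝ × ℝ => q.1 * gaussMap q.1) p := continuousAt_fst.mul hgauss
  refine hgauss.prodMk ?_
  rcases lt_or_gt_of_ne hp.2.2.2.1 with h | h
  · refine (continuousAt_snd.neg).congr ?_
    filter_upwards [hevρ, continuousAt_snd.eventually (gt_mem_nhds h)] with q hq hq'
    exact (fiberMap_of_nonpos hq (le_of_lt hq')).symm
  · have hev := continuousAt_snd.eventually (lt_mem_nhds h)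
    rcases lt_or_gt_of_ne hp.ne_mul_gaussMap with h' | h'
    · refine (continuousAt_snd.neg.div hmul hpos.ne').congr ?_
      filter_upwards [hevρ, hev, continuousAt_snd.eventually_lt hmul h'] with q h1 h2 h3
      exact (fiberMap_of_le h1 h2 h3.le).symm
    · have h1 : ContinuousAt (fun q : ℝ × ℝ => Int.fract ((1 - q.2) / q.1)) p :=
        ContinuousAt.comp (g := Int.fract) (f := fun q : ℝ × ℝ => (1 - q.2) / q.1)
          (continuousAt_fract (hp.sub_div_ne _))
          ((continuousAt_const.sub continuousAt_snd).div continuousAt_fst hρ.ne')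
      refine h1.congr ?_
      filter_upwards [hevρ, hev, hmul.eventually_lt continuousAt_snd h'] with q h1 h2 h3
      exact (fiberMap_of_gt h1 h2 h3).symm

theorem continuousAt_skewProd_iterate {p : ℝ × ℝ} (hp : ∀ n, RegularPoint (skewProd^[n] p))
    (n : ℕ) : ContinuousAt skewProd^[n] p := by
  induction n with
  | zero => exact continuousAt_id
  | succ n ih =>
    rw [Function.iterate_succ']
    exact (hp n).continuousAt.comp ih

/-- The interior of the set of points whose forward orbit visits `U`. -/
def visiting (U : Set (ℝ × ℝ)) : Set (ℝ × ℝ) := interior {p | ∃ n, skewProd^[n] p ∈ U}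

theorem volume_Rect_diff_visiting {r s u v e : ℝ} (hr : 0 < r) (hrs : r < s) (hs : s < 1)
    (he : e = 0 ∨ e = -1) (hu : e < u) (huv : u < v) (hv : v < e + 1) :
    volume (Rect \ visiting (Ioo r s ×ˢ Ioo u v)) = 0 := by
  have hmeas : MeasurableSet (Rect \ visiting (Ioo r s ×ˢ Ioo u v)) :=
    (measurableSet_Icc.prod measurableSet_Icc).diff isOpen_interior.measurableSet
  rw [Measure.volume_eq_prod]
  refine Measure.measure_prod_null_of_ae_null hmeas ?_
  have hends : ∀ᵐ ρ ∂(volume : Measure ℝ), ρ ∉ ({0, 1} : Set ℝ) :=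
    measure_eq_zero_iff_ae_notMem.1 ((Set.toFinite _).measure_zero _)
  filter_upwards [ae_frequently_gaussMap_mem, hends] with ρ hρ hρ01
  by_cases hmem : ρ ∈ Ioo (0 : ℝ) 1
  swap
  · refine measure_mono_null (t := ∅) (fun α hα => hmem ?_) measure_empty
    simp only [mem_insert_iff, mem_singleton_iff, not_or] at hρ01
    have := hα.1.1
    exact ⟨lt_of_le_of_ne this.1 (Ne.symm hρ01.1), lt_of_le_of_ne this.2 hρ01.2⟩
  obtain ⟨hirr, hfreq⟩ := hρ hmem
  have hfreq' := hfreq ((1 + r) / (2 + r)) ((1 + s) / (2 + s)) (by positivity)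
    (by rw [div_lt_div_iff₀ (by linarith) (by linarith)]; nlinarith)
    (by rw [div_lt_one (by linarith)]; linarith)
  have h1 := volume_fiber_avoiding (u := (2 * u + v) / 3) (v := (u + 2 * v) / 3) hr hrs hs he
    (by linarith) (by linarith) (by linarith) hfreq'
  have h2 := (countable_not_regular hmem hirr).measure_zero volume
  have h3 : volume ({-1, 1} : Set ℝ) = 0 := (Set.toFinite _).measure_zero _
  refine measure_mono_null ?_ (measure_union_null (measure_union_null h1 h2) h3)
  rintro α ⟨hα, hnot⟩
  by_contra hcon
  simp only [mem_union, not_or, Set.mem_ofPred_eq, mem_insert_iff, mem_singleton_iff] at hcon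
  obtain ⟨⟨hc1, hc2⟩, hc3, hc4⟩ := hcon
  have hα1 : α ∈ Ioo (-1 : ℝ) 1 :=
    ⟨lt_of_le_of_ne hα.2.1 (Ne.symm hc3), lt_of_le_of_ne hα.2.2 hc4⟩
  have hreg : ∀ n, RegularPoint (skewProd^[n] (ρ, α)) := by
    by_contra h
    exact hc2 ⟨hα1, h⟩
  have hvisit : ∃ n, skewProd^[n] (ρ, α) ∈ Ioo r s ×ˢ Icc ((2 * u + v) / 3) ((u + 2 * v) / 3) := by
    by_contra! h
    exact hc1 ⟨hreg, h⟩
  obtain ⟨n, hn⟩ := hvisit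
  refine hnot (mem_interior_iff_mem_nhds.2 ?_)
  have hU : Ioo r s ×ˢ Ioo u v ∈ 𝓝 (skewProd^[n] (ρ, α)) :=
    (isOpen_Ioo.prod isOpen_Ioo).mem_nhds
      ⟨hn.1, by linarith [hn.2.1], by linarith [hn.2.2]⟩
  filter_upwards [(continuousAt_skewProd_iterate hreg n) hU] with q hq
  exact ⟨n, hq⟩

theorem dense_preimage_Rect_of_volume_diff {V : Set (ℝ × ℝ)} (hV : volume (Rect \ V) = 0) :
    Dense (Subtype.val ⁻¹' V : Set ↥Rect) := by
  have hcl : closure (Ioo (0 : ℝ) 1 ×ˢ Ioo (-1 : ℝ) 1) = Rect := by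
    rw [closure_prod_eq, closure_Ioo (by norm_num), closure_Ioo (by norm_num), Rect]
  rw [Subtype.dense_iff, Subtype.image_preimage_coe]
  nth_rewrite 1 [← hcl]
  refine closure_minimal (fun p hp => mem_closure_iff.2 fun O hO hpO => ?_) isClosed_closure
  by_contra hempty
  rw [Set.not_nonempty_iff_eq_empty] at hempty
  have hopen : IsOpen (O ∩ Ioo (0 : ℝ) 1 ×ˢ Ioo (-1 : ℝ) 1) :=
    hO.inter (isOpen_Ioo.prod isOpen_Ioo)
  refine (hopen.measure_pos volume ⟨p, hpO, hp⟩).ne' (measure_mono_null ?_ hV)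
  rintro q ⟨hqO, hq⟩
  have hqR : q ∈ Rect := hcl ▸ subset_closure hq
  exact ⟨hqR, fun hqV => (hempty ▸ ⟨hqO, hqR, hqV⟩ : q ∈ (∅ : Set (ℝ × ℝ)))⟩

/-- Corners `((r, s), (u, v))` of the rational boxes `(r, s) × (u, v)` used to test density. -/
def rationalBoxes : Set ((ℚ × ℚ) × (ℚ × ℚ)) :=
  {b | 0 < b.1.1 ∧ b.1.1 < b.1.2 ∧ b.1.2 < 1 ∧ b.2.1 < b.2.2 ∧
    ((0 < b.2.1 ∧ b.2.2 < 1) ∨ (-1 < b.2.1 ∧ b.2.2 < 0))}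

/-- The open box with corners `b`. -/
def realBox (b : (ℚ × ℚ) × (ℚ × ℚ)) : Set (ℝ × ℝ) :=
  Ioo (b.1.1 : ℝ) b.1.2 ×ˢ Ioo (b.2.1 : ℝ) b.2.2

theorem volume_Rect_diff_visiting_realBox {b : (ℚ × ℚ) × (ℚ × ℚ)} (hb : b ∈ rationalBoxes) :
    volume (Rect \ visiting (realBox b)) = 0 := by
  obtain ⟨h1, h2, h3, h4, h5⟩ := hb
  rcases h5 with ⟨h5, h6⟩ | ⟨h5, h6⟩
  · exact volume_Rect_diff_visiting (e := 0) (by exact_mod_cast h1) (by exact_mod_cast h2)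
      (by exact_mod_cast h3) (Or.inl rfl) (by exact_mod_cast h5) (by exact_mod_cast h4)
      (by rw [zero_add]; exact_mod_cast h6)
  · exact volume_Rect_diff_visiting (e := -1) (by exact_mod_cast h1) (by exact_mod_cast h2)
      (by exact_mod_cast h3) (Or.inr rfl) (by exact_mod_cast h5) (by exact_mod_cast h4)
      (by rw [neg_add_cancel]; exact_mod_cast h6)

theorem exists_rational_Ioo_subset {x : ℝ} {s : Set ℝ} (hs : s ∈ 𝓝 x) :
    ∃ a b : ℚ, (a : ℝ) < x ∧ x < b ∧ Icc (a : ℝ) b ⊆ s := by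
  obtain ⟨l, r, hlr, hsub⟩ := mem_nhds_iff_exists_Ioo_subset.1 hs
  obtain ⟨a, ha1, ha2⟩ := exists_rat_btwn hlr.1
  obtain ⟨b, hb1, hb2⟩ := exists_rat_btwn hlr.2
  exact ⟨a, b, ha2, hb1, (Icc_subset_Ioo ha1 hb2).trans hsub⟩

theorem Rect_subset_closure_of_meets_boxes {S : Set (ℝ × ℝ)}
    (hS : ∀ b ∈ rationalBoxes, (S ∩ realBox b).Nonempty) : Rect ⊆ closure S := by
  have hcl : closure (Ioo (0 : ℝ) 1 ×ˢ (Ioo (-1 : ℝ) 0 ∪ Ioo (0 : ℝ) 1)) = Rect := by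
    rw [closure_prod_eq, closure_union, closure_Ioo (by norm_num), closure_Ioo (by norm_num),
      Icc_union_Icc_eq_Icc (by norm_num) (by norm_num), Rect]
  rw [← hcl]
  refine closure_minimal (fun q hq => mem_closure_iff_nhds.2 fun O hO => ?_) isClosed_closure
  obtain ⟨s, hs, t, ht, hst⟩ := mem_nhds_prod_iff.1 hO
  obtain ⟨a, b, ha, hb, hab⟩ :=
    exists_rational_Ioo_subset (inter_mem hs (isOpen_Ioo.mem_nhds hq.1))
  obtain ⟨c, d, hc, hd, hcd, hsign⟩ : ∃ c d : ℚ, (c : ℝ) < q.2 ∧ q.2 < d ∧ Icc (c : ℝ) d ⊆ t ∧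
      ((0 < c ∧ d < 1) ∨ (-1 < c ∧ d < 0)) := by
    rcases hq.2 with h | h
    · obtain ⟨c, d, hc, hd, hcd⟩ := exists_rational_Ioo_subset (inter_mem ht (isOpen_Ioo.mem_nhds h))
      have h1 := (hcd ⟨le_rfl, (hc.trans hd).le⟩).2.1
      have h2 := (hcd ⟨(hc.trans hd).le, le_rfl⟩).2.2
      exact ⟨c, d, hc, hd, hcd.trans inter_subset_left,
        Or.inr ⟨by exact_mod_cast h1, by exact_mod_cast h2⟩⟩
    · obtain ⟨c, d, hc, hd, hcd⟩ := exists_rational_Ioo_subset (inter_mem ht (isOpen_Ioo.mem_nhds h))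
      have h1 := (hcd ⟨le_rfl, (hc.trans hd).le⟩).2.1
      have h2 := (hcd ⟨(hc.trans hd).le, le_rfl⟩).2.2
      exact ⟨c, d, hc, hd, hcd.trans inter_subset_left,
        Or.inl ⟨by exact_mod_cast h1, by exact_mod_cast h2⟩⟩
  have h1 := (hab ⟨le_rfl, (ha.trans hb).le⟩).2.1
  have h2 := (hab ⟨(ha.trans hb).le, le_rfl⟩).2.2
  obtain ⟨z, hzS, hz⟩ := hS ((a, b), (c, d)) ⟨by exact_mod_cast h1, by exact_mod_cast ha.trans hb,
    by exact_mod_cast h2, by exact_mod_cast hc.trans hd, hsign⟩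
  exact ⟨z, hst ⟨(hab (Ioo_subset_Icc_self hz.1)).1, hcd (Ioo_subset_Icc_self hz.2)⟩, hzS⟩

/-- **Proposition 3.1.** There is a set `𝒢₀ ⊆ R = [0,1]×[-1,1]`, containing a residual subset
of `R` and of full Lebesgue measure in `R`, such that every point of `𝒢₀` has dense forward
orbit under the skew product `T`. -/
theorem genericOrbitsDense :
    ∃ G0 : Set (ℝ × ℝ), G0 ⊆ Rect ∧
      (Subtype.val ⁻¹' G0 : Set ↥Rect) ∈ residual ↥Rect ∧
      volume (Rect \ G0) = 0 ∧
      ∀ p ∈ G0, Rect ⊆ closure (Set.range fun n : ℕ => skewProd^[n] p) := by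
  have hcount : rationalBoxes.Countable := Set.to_countable _
  refine ⟨Rect ∩ ⋂ b ∈ rationalBoxes, visiting (realBox b), inter_subset_left, ?_, ?_, ?_⟩
  · have hpre : (Subtype.val ⁻¹' (Rect ∩ ⋂ b ∈ rationalBoxes, visiting (realBox b)) : Set ↥Rect)
        = ⋂ b ∈ rationalBoxes, (Subtype.val ⁻¹' visiting (realBox b) : Set ↥Rect) := by
      rw [preimage_inter, Subtype.coe_preimage_self, univ_inter, preimage_iInter₂]
    rw [hpre]
    exact (countable_bInter_mem hcount).2 fun b hb =>
      residual_of_dense_open (isOpen_interior.preimage continuous_subtype_val)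
        (dense_preimage_Rect_of_volume_diff (volume_Rect_diff_visiting_realBox hb))
  · simp only [sdiff_self_inter, sdiff_iInter]
    exact (measure_biUnion_null_iff hcount).2 fun b hb => volume_Rect_diff_visiting_realBox hb
  · rintro p ⟨-, hp⟩
    refine Rect_subset_closure_of_meets_boxes fun b hb => ?_
    obtain ⟨n, hn⟩ := interior_subset (mem_iInter₂.1 hp b hb)
    exact ⟨_, ⟨n, rfl⟩, hn⟩
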